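/- For a bounded t-structure on a triangulated category C with heart A, the inclusion A ↪ C induces an isomorphism of Grothendieck groups K(A) ≅ K(C). -/

import Mathlib

open CategoryTheory Category Limits Pretriangulated

universe v u

variable (C : Type u) [Category.{v} C] [HasZeroObject C] [HasShift C ℤ]
  [Preadditive C] [∀ n : ℤ, (CategoryTheory.shiftFunctor C n).Additive] [Pretriangulated C]

namespace Paper

/-- The right perpendicular of a set of objects. -/
def perpSet (D : Set C) : Set C := {c | ∀ d ∈ D, ∀ φ : d ⟶ c, φ = 0}

/-- A `t`-structure given by its aisle `D`. -/
structure IsTStructure (D : Set C) : Prop where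
  isoClosed : ∀ {x y : C}, (x ≅ y) → x ∈ D → y ∈ D
  shift_mem : ∀ d ∈ D, d⟦(1 : ℤ)⟧ ∈ D
  exists_triangle : ∀ c : C, ∃ d ∈ D, ∃ d' ∈ perpSet C D,
    ∃ (f : d ⟶ c) (g : c ⟶ d') (h : d' ⟶ d⟦(1 : ℤ)⟧),
      Triangle.mk f g h ∈ distTriang C

/-- The shift `S[n]` of a set of objects. -/
def shiftSet (S : Set C) (n : ℤ) : Set C := {c | c⟦(-n : ℤ)⟧ ∈ S}

/-- The heart `D ∩ D^⊥[1]` of a `t`-structure. -/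
def heartSet (D : Set C) : Set C := {c | c ∈ D ∧ c⟦(-1 : ℤ)⟧ ∈ perpSet C D}

/-- Boundedness: every object lies in `D[-n] ∩ D^⊥[n]` for some `n`. -/
def IsBounded (D : Set C) : Prop :=
  ∀ c : C, ∃ n : ℕ, c⟦(n : ℤ)⟧ ∈ D ∧ c⟦(-(n : ℤ))⟧ ∈ perpSet C D

/-- A short exact sequence `0 → t → a → f → 0` in the heart `A`, encoded as a
distinguished triangle `t → a → f → t[1]` whose objects all lie in `A`. -/
def heartTriangle (A : Set C) (t a f : C) : Prop :=
  t ∈ A ∧ a ∈ A ∧ f ∈ A ∧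
    ∃ (i : t ⟶ a) (p : a ⟶ f) (h : f ⟶ t⟦(1 : ℤ)⟧), Triangle.mk i p h ∈ distTriang C

/-- `x` is a simple object of the heart `A`. -/
def SimpleIn (A : Set C) (x : C) : Prop :=
  x ∈ A ∧ ¬ IsZero x ∧ ∀ t f : C, heartTriangle C A t x f → IsZero t ∨ IsZero f

/-- The extension-closed subcategory of `C` generated by `S`. -/
inductive ExtClosure (S : Set C) : C → Prop
  | of {c : C} (h : c ∈ S) : ExtClosure S c
  | zero {c : C} (h : IsZero c) : ExtClosure S c
  | iso {x y : C} (e : x ≅ y) (h : ExtClosure S x) : ExtClosure S y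
  | ext {a b c : C} (f : a ⟶ b) (g : b ⟶ c) (h : c ⟶ a⟦(1 : ℤ)⟧)
      (hT : Triangle.mk f g h ∈ distTriang C)
      (ha : ExtClosure S a) (hc : ExtClosure S c) : ExtClosure S b

/-- The extension closure of `S` inside the heart `A`. -/
inductive HeartExt (A : Set C) (S : Set C) : C → Prop
  | of {c : C} (h : c ∈ S) : HeartExt A S c
  | zero {c : C} (h : IsZero c) (hA : c ∈ A) : HeartExt A S c
  | iso {x y : C} (e : x ≅ y) (hy : y ∈ A) (h : HeartExt A S x) : HeartExt A S y
  | ext {t a f : C} (ht : HeartExt A S t) (hf : HeartExt A S f)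
      (h : heartTriangle C A t a f) : HeartExt A S a

/-- A torsion pair `(T, F)` in the heart `A`. -/
structure TorsionPairIn (A T F : Set C) : Prop where
  subT : T ⊆ A
  subF : F ⊆ A
  isoT : ∀ {x y : C}, (x ≅ y) → x ∈ T → y ∈ T
  isoF : ∀ {x y : C}, (x ≅ y) → x ∈ F → y ∈ F
  hom_zero : ∀ t ∈ T, ∀ f ∈ F, ∀ φ : t ⟶ f, φ = 0
  exists_ses : ∀ a ∈ A, ∃ t ∈ T, ∃ f ∈ F, heartTriangle C A t a f

/-- The perpendicular of `T` taken inside the heart `A`. -/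
def perpIn (A T : Set C) : Set C := {a | a ∈ A ∧ ∀ t ∈ T, ∀ φ : t ⟶ a, φ = 0}

/-- The left tilt `⟨F, T[-1]⟩` of the heart `A` at a torsion class `T` (with `F = T^⊥ ∩ A`). -/
def leftTilt (A T : Set C) : Set C :=
  {c | ExtClosure C (perpIn C A T ∪ shiftSet C T (-1)) c}

/-- Objects of the heart `A` with a finite composition series. -/
inductive FiniteLengthIn (A : Set C) : C → Prop
  | zero {a : C} (h : IsZero a) : FiniteLengthIn A a
  | step {s a q : C} (hs : SimpleIn C A s) (hq : FiniteLengthIn A q)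
      (ht : heartTriangle C A s a q) : FiniteLengthIn A a


/-- The Grothendieck group of the triangulated category `C`. -/
def triangRel : AddSubgroup (FreeAbelianGroup C) :=
  AddSubgroup.closure {x | ∃ T : Triangle C, (T ∈ distTriang C) ∧
    x = FreeAbelianGroup.of T.obj₂ - FreeAbelianGroup.of T.obj₁ - FreeAbelianGroup.of T.obj₃}

def KTriang := FreeAbelianGroup C ⧸ triangRel C

instance : AddCommGroup (KTriang C) := by unfold KTriang; infer_instance

/-- The Grothendieck group of the heart `A` (relations from short exact sequences in `A`,
encoded by distinguished triangles with objects in `A`). -/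
def heartRel (A : Set C) : AddSubgroup (FreeAbelianGroup A) :=
  AddSubgroup.closure {x | ∃ t a f : A, heartTriangle C A t a f ∧
    x = FreeAbelianGroup.of a - FreeAbelianGroup.of t - FreeAbelianGroup.of f}

def KHeart (A : Set C) := FreeAbelianGroup A ⧸ heartRel C A

instance (A : Set C) : AddCommGroup (KHeart C A) := by unfold KHeart; infer_instance

section Truncation

open Triangulated

variable {C} (t : TStructure C)

/-- A morphism inducing bijections on morphisms from `t`-nonpositive objects becomes an isomorphism
after truncation. -/
lemma isIso_truncLT_map {Z T : C} (γ : Z ⟶ T)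
    (hinj : ∀ (W : C) [t.IsLE W 0] (z : W ⟶ Z), z ≫ γ = 0 → z = 0)
    (hsurj : ∀ (W : C) [t.IsLE W 0] (y : W ⟶ T), ∃ z : W ⟶ Z, z ≫ γ = y) :
    IsIso ((t.truncLT 1).map γ) := by
  have hZ : t.IsLE ((t.truncLT 1).obj Z) 0 := t.isLE_truncLT_obj ..
  have hT : t.IsLE ((t.truncLT 1).obj T) 0 := t.isLE_truncLT_obj ..
  have : t.IsLE ((t.truncLT 1).obj Z) (1 - 1) := t.isLE_truncLT_obj ..
  have : t.IsLE ((t.truncLT 1).obj T) (1 - 1) := t.isLE_truncLT_obj ..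
  have nat := (t.truncLTι 1).naturality γ
  dsimp only [Functor.id_map, Functor.id_obj] at nat
  obtain ⟨s, hs⟩ := hsurj _ ((t.truncLTι 1).app T)
  have hs' := t.liftTruncLT_ι s 0 1 (by simp)
  refine ⟨t.liftTruncLT s 0 1 (by simp), t.to_truncLT_obj_ext ?_, t.to_truncLT_obj_ext ?_⟩
  · rw [assoc, hs', id_comp, ← sub_eq_zero]
    apply hinj
    rw [Preadditive.sub_comp, assoc, hs, nat, sub_self]
  · rw [assoc, nat, reassoc_of% hs', hs, id_comp]

/-- A morphism inducing bijections on morphisms to `t`-positive objects becomes an isomorphism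
after truncation. -/
lemma isIso_truncGE_map {Z T : C} (γ : Z ⟶ T)
    (hinj : ∀ (V : C) [t.IsGE V 1] (z : T ⟶ V), γ ≫ z = 0 → z = 0)
    (hsurj : ∀ (V : C) [t.IsGE V 1] (y : Z ⟶ V), ∃ z : T ⟶ V, γ ≫ z = y) :
    IsIso ((t.truncGE 1).map γ) := by
  have nat := t.truncGEπ_naturality 1 γ
  obtain ⟨s, hs⟩ := hsurj _ ((t.truncGEπ 1).app Z)
  have hs' := t.π_descTruncGE s 1
  refine ⟨t.descTruncGE s 1, t.from_truncGE_obj_ext ?_, t.from_truncGE_obj_ext ?_⟩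
  · rw [reassoc_of% nat, hs', hs, comp_id]
  · rw [reassoc_of% hs', comp_id, ← sub_eq_zero]
    apply hinj
    rw [Preadditive.comp_sub, reassoc_of% hs, nat, sub_self]

lemma isIso_of_isIso_trunc_map {Z T : C} (γ : Z ⟶ T) [IsIso ((t.truncLT 1).map γ)]
    [IsIso ((t.truncGE 1).map γ)] : IsIso γ :=
  isIso₂_of_isIso₁₃ ((t.triangleLTGE 1).map γ) (t.triangleLTGE_distinguished 1 Z)
    (t.triangleLTGE_distinguished 1 T)
    (inferInstanceAs (IsIso ((t.truncLT 1).map γ))) (inferInstanceAs (IsIso ((t.truncGE 1).map γ)))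

section Exactness

variable {X Y Z : C} {f : X ⟶ Y} {g : Y ⟶ Z} {h : Z ⟶ X⟦(1 : ℤ)⟧}
  (H : Triangle.mk f g h ∈ distTriang C)

include H

lemma distTriang_comp₁₂ : f ≫ g = 0 := comp_distTriang_mor_zero₁₂ _ H

lemma distTriang_comp₃₁ : h ≫ f⟦(1 : ℤ)⟧' = 0 := comp_distTriang_mor_zero₃₁ _ H

lemma distTriang_lift₁ {W : C} (x : W ⟶ X⟦(1 : ℤ)⟧) (hx : x ≫ f⟦(1 : ℤ)⟧' = 0) :
    ∃ z : W ⟶ Z, x = z ≫ h :=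
  Triangle.coyoneda_exact₁ _ H x hx

lemma distTriang_lift₂ {W : C} (y : W ⟶ Y) (hy : y ≫ g = 0) : ∃ x : W ⟶ X, y = x ≫ f :=
  Triangle.coyoneda_exact₂ _ H y hy

lemma distTriang_lift₃ {W : C} (z : W ⟶ Z) (hz : z ≫ h = 0) : ∃ y : W ⟶ Y, z = y ≫ g :=
  Triangle.coyoneda_exact₃ _ H z hz

lemma distTriang_desc₂ {V : C} (y : Y ⟶ V) (hy : f ≫ y = 0) : ∃ z : Z ⟶ V, y = g ≫ z :=
  Triangle.yoneda_exact₂ _ H y hy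

lemma distTriang_desc₃ {V : C} (z : Z ⟶ V) (hz : g ≫ z = 0) :
    ∃ x : X⟦(1 : ℤ)⟧ ⟶ V, z = h ≫ x :=
  Triangle.yoneda_exact₃ _ H z hz

lemma rot_rot_distTriang : Triangle.mk h (-f⟦(1 : ℤ)⟧') (-g⟦(1 : ℤ)⟧') ∈ distTriang C :=
  rot_of_distTriang _ (rot_of_distTriang _ H)

lemma shift_distTriang :
    Triangle.mk (-f⟦(1 : ℤ)⟧') (-g⟦(1 : ℤ)⟧') (-h⟦(1 : ℤ)⟧') ∈ distTriang C :=
  rot_of_distTriang _ (rot_rot_distTriang H)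

lemma distTriang_lift₂_shift {W : C} (y : W ⟶ Y⟦(1 : ℤ)⟧) (hy : y ≫ g⟦(1 : ℤ)⟧' = 0) :
    ∃ x : W ⟶ X⟦(1 : ℤ)⟧, y = x ≫ f⟦(1 : ℤ)⟧' := by
  obtain ⟨x, hx⟩ := distTriang_lift₂ (shift_distTriang H) y (by simp [hy])
  exact ⟨-x, by simp [hx]⟩

lemma distTriang_lift₃_shift {W : C} (z : W ⟶ Z⟦(1 : ℤ)⟧) (hz : z ≫ h⟦(1 : ℤ)⟧' = 0) :
    ∃ y : W ⟶ Y⟦(1 : ℤ)⟧, z = y ≫ g⟦(1 : ℤ)⟧' := by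
  obtain ⟨y, hy⟩ := distTriang_lift₃ (shift_distTriang H) z (by simp [hz])
  exact ⟨-y, by simp [hy]⟩

lemma distTriang_desc₁ {V : C} (x : X⟦(1 : ℤ)⟧ ⟶ V) (hx : h ≫ x = 0) :
    ∃ y : Y⟦(1 : ℤ)⟧ ⟶ V, x = f⟦(1 : ℤ)⟧' ≫ y := by
  obtain ⟨y, hy⟩ := distTriang_desc₂ (rot_rot_distTriang H) x hx
  exact ⟨-y, by simp [hy]⟩

lemma distTriang_desc₂_shift {V : C} (y : Y⟦(1 : ℤ)⟧ ⟶ V) (hy : f⟦(1 : ℤ)⟧' ≫ y = 0) :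
    ∃ z : Z⟦(1 : ℤ)⟧ ⟶ V, y = g⟦(1 : ℤ)⟧' ≫ z := by
  obtain ⟨z, hz⟩ := distTriang_desc₂ (shift_distTriang H) y (by simp [hy])
  exact ⟨-z, by simp [hz]⟩

lemma distTriang_desc₃_shift {V : C} (z : Z⟦(1 : ℤ)⟧ ⟶ V) (hz : g⟦(1 : ℤ)⟧' ≫ z = 0) :
    ∃ x : X⟦(1 : ℤ)⟧⟦(1 : ℤ)⟧ ⟶ V, z = h⟦(1 : ℤ)⟧' ≫ x := by
  obtain ⟨x, hx⟩ := distTriang_desc₃ (shift_distTriang H) z (by simp [hz])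
  exact ⟨-x, by simp [hx]⟩

end Exactness

section Octahedron

variable {A X X' Y Y' Z : C} {i : A ⟶ X} {p : X ⟶ X'} {d : X' ⟶ A⟦(1 : ℤ)⟧}
  {f : X ⟶ Y} {g : Y ⟶ Z} {h : Z ⟶ X⟦(1 : ℤ)⟧} {q : Y ⟶ Y'} {δ : Y' ⟶ A⟦(1 : ℤ)⟧}

/-- The quotient of a nonnegative object `Y` by the truncation `A` of a subobject `X` (in the sense
that the cone of `X ⟶ Y` is nonnegative) is nonnegative. -/
lemma isGE_cone (hX : Triangle.mk i p d ∈ distTriang C) (hY : Triangle.mk f g h ∈ distTriang C)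
    (hA : Triangle.mk (i ≫ f) q δ ∈ distTriang C) [t.IsGE X' 1] [t.IsGE Y 0] [t.IsGE Z 0] :
    t.IsGE Y' 0 := by
  rw [t.isGE_iff_orthogonal (-1) 0 (by simp)]
  intro W y _
  have h₁ : ((y ≫ δ) ≫ i⟦(1 : ℤ)⟧') ≫ f⟦(1 : ℤ)⟧' = 0 := by
    rw [assoc, assoc, ← Functor.map_comp, distTriang_comp₃₁ hA, comp_zero]
  obtain ⟨z, hz⟩ := distTriang_lift₁ hY _ h₁
  rw [t.zero z (-1) 0, zero_comp] at hz
  obtain ⟨x, hx⟩ := distTriang_lift₁ hX _ hz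
  rw [t.zero x (-1) 1, zero_comp] at hx
  obtain ⟨y', hy'⟩ := distTriang_lift₃ hA y hx
  rw [hy', t.zero y' (-1) 0, zero_comp]

/-- An instance of the octahedron axiom which holds in any pretriangulated category: the
composition of the truncation `A ⟶ X` of a nonnegative object with a morphism `X ⟶ Y` whose
cone `Z` is nonnegative. -/
lemma exists_distTriang_of_trunc (hX : Triangle.mk i p d ∈ distTriang C)
    (hY : Triangle.mk f g h ∈ distTriang C) (hA : Triangle.mk (i ≫ f) q δ ∈ distTriang C)
    [t.IsLE A 0] [t.IsGE X' 1] [t.IsGE Y 0] [t.IsGE Z 0] :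
    ∃ (u : X' ⟶ Y') (v : Y' ⟶ Z) (w : Z ⟶ X'⟦(1 : ℤ)⟧), Triangle.mk u v w ∈ distTriang C := by
  have hY' : t.IsGE Y' 0 := isGE_cone t hX hY hA
  have hA1 : t.IsLE (A⟦(1 : ℤ)⟧) (-1) := t.isLE_shift A 0 1 (-1)
  have hA2 : t.IsLE (A⟦(1 : ℤ)⟧⟦(1 : ℤ)⟧) (-2) := t.isLE_shift _ (-1) 1 (-2)
  have hX1 : t.IsGE (X'⟦(1 : ℤ)⟧) 0 := t.isGE_shift X' 1 1 0
  obtain ⟨u, hu, hdu⟩ : ∃ u : X' ⟶ Y', p ≫ u = f ≫ q ∧ d ≫ (𝟙 A)⟦(1 : ℤ)⟧' = u ≫ δ :=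
    complete_distinguished_triangle_morphism _ _ hX hA (𝟙 A) f (id_comp _).symm
  obtain ⟨e, he, hde⟩ : ∃ e : Y' ⟶ Z, q ≫ e = 𝟙 Y ≫ g ∧ δ ≫ i⟦(1 : ℤ)⟧' = e ≫ h :=
    complete_distinguished_triangle_morphism _ _ hA hY i (𝟙 Y) (comp_id _)
  rw [CategoryTheory.Functor.map_id, comp_id] at hdu
  rw [id_comp] at he
  obtain ⟨T, v, w, hT⟩ := distinguished_cocone_triangle u
  obtain ⟨γ, hγ, hhγ⟩ : ∃ γ : Z ⟶ T, g ≫ γ = q ≫ v ∧ h ≫ p⟦(1 : ℤ)⟧' = γ ≫ w :=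
    complete_distinguished_triangle_morphism _ _ hY hT p q hu.symm
  have hT0 : t.IsGE T 0 := t.isGE₂ _ (rot_of_distTriang _ hT) 0 hY' hX1
  have heγ : e ≫ γ = v := by
    rw [← sub_eq_zero]
    obtain ⟨x, hx⟩ := distTriang_desc₃ hA (e ≫ γ - v)
      (by rw [Preadditive.comp_sub, reassoc_of% he, hγ, sub_self])
    rw [hx, t.zero x (-1) 0, comp_zero]
  have hLT : IsIso ((t.truncLT 1).map γ) := by
    refine isIso_truncLT_map t γ (fun W _ z hz ↦ ?_) (fun W _ y ↦ ?_)
    · have h₁ : (z ≫ h) ≫ p⟦(1 : ℤ)⟧' = 0 := by rw [assoc, hhγ, reassoc_of% hz, zero_comp]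
      obtain ⟨a, ha⟩ := distTriang_lift₂_shift hX (z ≫ h) h₁
      obtain ⟨b, rfl⟩ := distTriang_lift₁ hA a (by
        rw [Functor.map_comp, ← reassoc_of% ha, distTriang_comp₃₁ hY, comp_zero])
      rw [assoc, hde, ← sub_eq_zero, ← assoc, ← Preadditive.sub_comp] at ha
      obtain ⟨y, hy⟩ := distTriang_lift₃ hY _ ha
      obtain rfl : z = (b + y ≫ q) ≫ e := by
        rw [Preadditive.add_comp, assoc, he, ← hy]
        abel
      rw [assoc, heγ] at hz
      obtain ⟨x, hx⟩ := distTriang_lift₂ hT _ hz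
      rw [hx, t.zero x 0 1, zero_comp, zero_comp]
    · obtain ⟨x, hx⟩ := distTriang_lift₃_shift hX (y ≫ w) (by
        rw [hdu, Functor.map_comp, assoc, reassoc_of% (distTriang_comp₃₁ hT), zero_comp, comp_zero])
      obtain ⟨a, ha⟩ := distTriang_lift₂_shift hA (x ≫ f⟦(1 : ℤ)⟧') (by
        rw [assoc, ← Functor.map_comp, ← hu, Functor.map_comp, ← reassoc_of% hx,
          distTriang_comp₃₁ hT, comp_zero])
      obtain ⟨z, hz⟩ := distTriang_lift₁ hY (x - a ≫ i⟦(1 : ℤ)⟧') (by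
        rw [Preadditive.sub_comp, assoc, ← Functor.map_comp, ← ha, sub_self])
      obtain ⟨y', hy'⟩ := distTriang_lift₃ hT (y - z ≫ γ) (by
        rw [Preadditive.sub_comp, assoc, ← hhγ, ← reassoc_of% hz, Preadditive.sub_comp, assoc,
          ← Functor.map_comp, distTriang_comp₁₂ hX, Functor.map_zero, comp_zero, sub_zero, hx,
          sub_self])
      refine ⟨z + y' ≫ e, ?_⟩
      rw [Preadditive.add_comp, assoc, heγ, ← hy']
      abel
  have hGE : IsIso ((t.truncGE 1).map γ) := by
    have hq {V : C} [t.IsGE V 1] (y : Y' ⟶ V) (hy : q ≫ y = 0) : y = 0 := by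
      obtain ⟨a, ha⟩ := distTriang_desc₃ hA y hy
      rw [ha, t.zero a (-1) 1, comp_zero]
    have hp {V : C} [t.IsGE V 1] (y : X' ⟶ V) (hy : p ≫ y = 0) : y = 0 := by
      obtain ⟨a, ha⟩ := distTriang_desc₃ hX y hy
      rw [ha, t.zero a (-1) 1, comp_zero]
    refine isIso_truncGE_map t γ (fun V _ z hz ↦ ?_) (fun V _ y ↦ ?_)
    · have hvz : v ≫ z = 0 := hq _ (by rw [← reassoc_of% hγ, hz, comp_zero])
      obtain ⟨ψ, rfl⟩ := distTriang_desc₃ hT z hvz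
      rw [← reassoc_of% hhγ] at hz
      obtain ⟨θ, hθ⟩ := distTriang_desc₁ hY _ hz
      obtain ⟨θ', rfl⟩ := distTriang_desc₂_shift hA θ (t.zero _ (-1) 1)
      rw [← Functor.map_comp_assoc, ← hu, Functor.map_comp_assoc, ← sub_eq_zero,
        ← Preadditive.comp_sub] at hθ
      obtain ⟨a, ha⟩ := distTriang_desc₃_shift hX _ hθ
      rw [t.zero a (-2) 1, comp_zero, sub_eq_zero] at ha
      rw [ha, ← assoc, distTriang_comp₃₁ hT, zero_comp]
    · obtain ⟨η, hη⟩ := distTriang_desc₂ hA (g ≫ y) (t.zero _ 0 1)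
      have huη : u ≫ η = 0 := hp _ (by
        rw [reassoc_of% hu, ← hη, reassoc_of% (distTriang_comp₁₂ hY), zero_comp])
      obtain ⟨φ, rfl⟩ := distTriang_desc₂ hT η huη
      obtain ⟨ψ, hψ⟩ := distTriang_desc₃ hY (y - γ ≫ φ)
        (by rw [Preadditive.comp_sub, hη, reassoc_of% hγ, sub_self])
      obtain ⟨ψ', rfl⟩ := distTriang_desc₂_shift hX ψ (t.zero _ (-1) 1)
      refine ⟨φ + w ≫ ψ', ?_⟩
      rw [Preadditive.comp_add, ← reassoc_of% hhγ, ← hψ]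
      abel
  have : IsIso γ := isIso_of_isIso_trunc_map t γ
  let e' : Z ≅ T := asIso γ
  refine ⟨u, v ≫ e'.inv, e'.hom ≫ w, isomorphic_distinguished _ hT _
    (Triangle.isoMk (Triangle.mk u (v ≫ e'.inv) (e'.hom ≫ w)) (Triangle.mk u v w)
      (Iso.refl X') (Iso.refl Y') e' ?_ ?_ ?_)⟩
  · exact (comp_id u).trans (id_comp u).symm
  · change (v ≫ e'.inv) ≫ e'.hom = 𝟙 Y' ≫ v
    rw [assoc, e'.inv_hom_id, comp_id, id_comp]
  · change (e'.hom ≫ w) ≫ (𝟙 X')⟦(1 : ℤ)⟧' = e'.hom ≫ w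
    rw [CategoryTheory.Functor.map_id, comp_id]

end Octahedron

end Truncation

section Quotient

open Triangulated

variable {C} (t : TStructure C)

lemma isGE_truncLT_obj (X : C) [t.IsGE X 0] : t.IsGE ((t.truncLT 1).obj X) 0 := by
  have : t.IsGE ((t.truncGE 1).obj X) 1 := t.isGE_truncGE_obj ..
  have : t.IsGE (((t.truncGE 1).obj X)⟦(-1 : ℤ)⟧) 2 := t.isGE_shift _ 1 (-1) 2
  exact t.isGE₂ _ (inv_rot_of_distTriang _ (t.triangleLTGE_distinguished 1 X)) 0
    (t.isGE_of_ge (((t.truncGE 1).obj X)⟦(-1 : ℤ)⟧) 0 2) ‹_›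

lemma isLE_of_distTriang {A X X' : C} {i : A ⟶ X} {p : X ⟶ X'} {d : X' ⟶ A⟦(1 : ℤ)⟧}
    (hX : Triangle.mk i p d ∈ distTriang C) [t.IsLE A 0] (n : ℤ) (hn : -1 ≤ n) [t.IsLE X n] :
    t.IsLE X' n := by
  have hA1 : t.IsLE (A⟦(1 : ℤ)⟧) (-1) := t.isLE_shift A 0 1 (-1)
  exact t.isLE₂ _ (rot_of_distTriang _ hX) n ‹_› (t.isLE_of_le (A⟦(1 : ℤ)⟧) (-1) n)

variable {A Y Y' : C} {i : A ⟶ Y} {q : Y ⟶ Y'} {δ : Y' ⟶ A⟦(1 : ℤ)⟧}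

lemma isIso_truncGE_map_of_distTriang (H : Triangle.mk i q δ ∈ distTriang C) [t.IsLE A 0] :
    IsIso ((t.truncGE 1).map q) := by
  have hA1 : t.IsLE (A⟦(1 : ℤ)⟧) (-1) := t.isLE_shift A 0 1 (-1)
  refine isIso_truncGE_map t q (fun V _ z hz ↦ ?_) (fun V _ y ↦ ?_)
  · obtain ⟨a, rfl⟩ := distTriang_desc₃ H z hz
    rw [t.zero a (-1) 1, comp_zero]
  · obtain ⟨z, hz⟩ := distTriang_desc₂ H y (t.zero _ 0 1)
    exact ⟨z, hz.symm⟩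

/-- The quotient of the truncation of `Y` by `A` is the truncation of the quotient of `Y` by `A`. -/
lemma exists_distTriang_truncLT (H : Triangle.mk i q δ ∈ distTriang C) [t.IsLE A 0]
    [t.IsGE Y' 0] :
    ∃ (Q : C) (l : A ⟶ (t.truncLT 1).obj Y) (m : (t.truncLT 1).obj Y ⟶ Q) (k : Q ⟶ A⟦(1 : ℤ)⟧),
      Triangle.mk l m k ∈ distTriang C ∧ Nonempty (Q ≅ (t.truncLT 1).obj Y') := by
  have hB : t.IsLE ((t.truncLT 1).obj Y) 0 := t.isLE_truncLT_obj ..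
  have hY₁ : t.IsGE ((t.truncGE 1).obj Y) 1 := t.isGE_truncGE_obj ..
  have hι : Triangle.mk ((t.truncLTι 1).app Y) ((t.truncGEπ 1).app Y)
    ((t.truncGEδLT 1).app Y) ∈ distTriang C := t.triangleLTGE_distinguished 1 Y
  set ι : (t.truncLT 1).obj Y ⟶ Y := (t.truncLTι 1).app Y
  have hl := t.liftTruncLT_ι i 0 1 (by simp)
  set l := t.liftTruncLT i 0 1 (by simp)
  obtain ⟨Q, m, k, hQ⟩ := distinguished_cocone_triangle l
  obtain ⟨κ, hκ, hkκ⟩ : ∃ κ : Q ⟶ Y', m ≫ κ = ι ≫ q ∧ k ≫ (𝟙 A)⟦(1 : ℤ)⟧' = κ ≫ δ :=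
    complete_distinguished_triangle_morphism _ _ hQ H (𝟙 A) ι (hl.trans (id_comp _).symm)
  rw [CategoryTheory.Functor.map_id, comp_id] at hkκ
  have hQ0 : t.IsLE Q 0 := isLE_of_distTriang t hQ 0 (by simp)
  have hκ' : IsIso ((t.truncLT 1).map κ) := by
    refine isIso_truncLT_map t κ (fun W _ x hx ↦ ?_) (fun W _ y ↦ ?_)
    · obtain ⟨b, rfl⟩ := distTriang_lift₃ hQ x (by rw [hkκ, reassoc_of% hx, zero_comp])
      rw [assoc, hκ, ← assoc] at hx
      obtain ⟨a, ha⟩ := distTriang_lift₂ H _ hx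
      have : t.IsLE W (1 - 1) := by simpa
      have hb : b = a ≫ l := t.to_truncLT_obj_ext (by
        change b ≫ ι = (a ≫ l) ≫ ι
        rw [ha, assoc, hl])
      rw [hb, assoc, distTriang_comp₁₂ hQ, comp_zero]
    · obtain ⟨z, hz⟩ := distTriang_lift₁ hι ((y ≫ δ) ≫ l⟦(1 : ℤ)⟧') (by
        rw [assoc, assoc, ← Functor.map_comp, hl, distTriang_comp₃₁ H, comp_zero])
      rw [t.zero z 0 1, zero_comp] at hz
      obtain ⟨x, hx⟩ := distTriang_lift₁ hQ _ hz
      obtain ⟨y₁, hy₁⟩ := distTriang_lift₃ H (y - x ≫ κ) (by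
        rw [Preadditive.sub_comp, assoc, ← hkκ, hx, sub_self])
      obtain ⟨b, rfl⟩ := distTriang_lift₂ hι y₁ (t.zero _ 0 1)
      refine ⟨x + b ≫ m, ?_⟩
      rw [Preadditive.add_comp, assoc, hκ, ← assoc, ← hy₁]
      abel
  refine ⟨Q, l, m, k, hQ, ⟨?_⟩⟩
  have := (t.isLE_iff_isIso_truncLTι_app 0 1 (by simp) Q).1 hQ0
  exact (asIso ((t.truncLTι 1).app Q)).symm ≪≫ asIso ((t.truncLT 1).map κ)

end Quotient

section Euler

open Triangulated ZeroObject

variable {C} (t : TStructure C) {G : Type*} [AddCommGroup G]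

lemma exists_distTriang_truncLT_truncGE (X : C) :
    ∃ (i : (t.truncLT 1).obj X ⟶ X) (p : X ⟶ (t.truncGE 1).obj X)
      (d : (t.truncGE 1).obj X ⟶ ((t.truncLT 1).obj X)⟦(1 : ℤ)⟧),
      Triangle.mk i p d ∈ distTriang C :=
  ⟨_, _, _, t.triangleLTGE_distinguished 1 X⟩

lemma heart_truncLT (X : C) [t.IsGE X 0] : t.heart ((t.truncLT 1).obj X) :=
  (t.mem_heart_iff _).2 ⟨t.isLE_truncLT_obj .., isGE_truncLT_obj t X⟩

lemma isGE_shift_truncGE (X : C) : t.IsGE (((t.truncGE 1).obj X)⟦(1 : ℤ)⟧) 0 :=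
  t.isGE_shift _ 1 1 0

/-- A function on objects is additive on the distinguished triangles in the heart. -/
def AdditiveOnHeart (c : C → G) : Prop :=
  ∀ ⦃X Y Z : C⦄ (f : X ⟶ Y) (g : Y ⟶ Z) (h : Z ⟶ X⟦(1 : ℤ)⟧), Triangle.mk f g h ∈ distTriang C →
    t.heart X → t.heart Y → t.heart Z → c Y = c X + c Z

/-- The alternating sum of the values of `c` at the first `n` cohomology objects of `X`, for `X`
nonnegative. -/
noncomputable def euler (c : C → G) : ℕ → C → G
  | 0, _ => 0
  | n + 1, X => c ((t.truncLT 1).obj X) - euler c n (((t.truncGE 1).obj X)⟦(1 : ℤ)⟧)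

variable {t} {c : C → G} (hc : AdditiveOnHeart t c)

include hc

lemma AdditiveOnHeart.isZero {X : C} (hX : IsZero X) : c X = 0 := by
  have hX' : t.heart X :=
    (t.mem_heart_iff X).2 ⟨t.isLE_of_isZero hX 0, t.isGE_of_isZero hX 0⟩
  have H : Triangle.mk (𝟙 X) (0 : X ⟶ X) 0 ∈ distTriang C :=
    (Triangle.distinguished_iff_of_isZero₃ (Triangle.mk (𝟙 X) (0 : X ⟶ X) 0) hX).2
      (inferInstanceAs (IsIso (𝟙 X)))
  simpa using hc _ _ _ H hX' hX' hX'

lemma AdditiveOnHeart.iso {X Y : C} (e : X ≅ Y) (hX : t.heart X) : c X = c Y := by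
  have h0 : t.heart (0 : C) :=
    (t.mem_heart_iff _).2 ⟨inferInstance, inferInstance⟩
  have H : Triangle.mk e.hom (0 : Y ⟶ 0) 0 ∈ distTriang C :=
    (Triangle.distinguished_iff_of_isZero₃ (Triangle.mk e.hom (0 : Y ⟶ 0) 0) (isZero_zero C)).2
      (inferInstanceAs (IsIso e.hom))
  rw [hc _ _ _ H hX (t.heart.prop_of_iso e hX) h0, hc.isZero (isZero_zero C), add_zero]

lemma euler_congr (n : ℕ) :
    ∀ {X Y : C} (_ : X ≅ Y) [t.IsGE X 0], euler t c n X = euler t c n Y := by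
  induction n with
  | zero => intros; rfl
  | succ n ih =>
    intro X Y e _
    have := isGE_shift_truncGE t X
    rw [euler, euler, hc.iso ((t.truncLT 1).mapIso e) (heart_truncLT t X),
      ih ((shiftFunctor C (1 : ℤ)).mapIso ((t.truncGE 1).mapIso e))]

lemma euler_succ (n : ℕ) {A X X' : C} {i : A ⟶ X} {p : X ⟶ X'} {d : X' ⟶ A⟦(1 : ℤ)⟧}
    (H : Triangle.mk i p d ∈ distTriang C) [t.IsLE A 0] [t.IsGE X 0] [t.IsGE X' 1] :
    euler t c (n + 1) X = c A - euler t c n (X'⟦(1 : ℤ)⟧) := by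
  have := isGE_shift_truncGE t X
  obtain ⟨e, -⟩ := TStructure.triangle_iso_exists t (t.triangleLTGE_distinguished 1 X) H
    (Iso.refl X) 0 1 (t.isLE_truncLT_obj ..) (t.isGE_truncGE_obj ..) ‹_› ‹_›
  have e₁ : (t.truncLT 1).obj X ≅ A := Triangle.π₁.mapIso e
  have e₃ : (t.truncGE 1).obj X ≅ X' := Triangle.π₃.mapIso e
  rw [euler, hc.iso e₁ (heart_truncLT t X),
    euler_congr hc n ((shiftFunctor C (1 : ℤ)).mapIso e₃)]

lemma euler_isZero (n : ℕ) : ∀ {X : C} (_ : IsZero X), euler t c n X = 0 := by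
  induction n with
  | zero => intros; rfl
  | succ n ih =>
    intro X hX
    rw [euler, hc.isZero ((t.truncLT 1).map_isZero hX),
      ih ((shiftFunctor C (1 : ℤ)).map_isZero ((t.truncGE 1).map_isZero hX)), sub_zero]

lemma euler_succ_of_isLE (n : ℕ) : ∀ (X : C) [t.IsGE X 0] [t.IsLE X (n - 1)],
    euler t c (n + 1) X = euler t c n X := by
  induction n with
  | zero =>
    intro X _ h
    have : t.IsLE X (-1) := h
    rw [euler_isZero hc 1 (t.isZero X (-1) 0)]
    rfl
  | succ n ih =>
    intro X _ _
    have := isGE_shift_truncGE t X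
    have h₁ : t.IsLE ((t.truncLT 1).obj X) 0 := t.isLE_truncLT_obj ..
    have h₂ : t.IsLE X n := t.isLE_of_le _ ((n + 1 : ℕ) - 1 : ℤ) n
    obtain ⟨i, p, d, hT⟩ := exists_distTriang_truncLT_truncGE t X
    have h₃ : t.IsLE ((t.truncGE 1).obj X) n :=
      isLE_of_distTriang t hT n (by lia)
    have h₄ : t.IsLE (((t.truncGE 1).obj X)⟦(1 : ℤ)⟧) (n - 1) := t.isLE_shift _ n 1 (n - 1)
    rw [euler, ih]
    rfl

lemma euler_eq_of_le {n m : ℕ} (hnm : n ≤ m) (X : C) [t.IsGE X 0] [t.IsLE X (n - 1)] :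
    euler t c m X = euler t c n X := by
  induction m, hnm using Nat.le_induction with
  | base => rfl
  | succ m hm ih =>
    have : t.IsLE X (m - 1) := t.isLE_of_le X (n - 1) (m - 1)
    rw [euler_succ_of_isLE hc, ih]

lemma euler_of_heart_distTriang (n : ℕ) {A Y Y' : C} {i : A ⟶ Y} {q : Y ⟶ Y'}
    {δ : Y' ⟶ A⟦(1 : ℤ)⟧} (H : Triangle.mk i q δ ∈ distTriang C) (hA : t.heart A)
    [t.IsGE Y 0] [t.IsGE Y' 0] :
    euler t c (n + 1) Y = c A + euler t c (n + 1) Y' := by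
  have := isGE_shift_truncGE t Y
  have := ((t.mem_heart_iff A).1 hA).1
  have := isIso_truncGE_map_of_distTriang t H
  obtain ⟨Q, l, m, k, hQ, ⟨e⟩⟩ := exists_distTriang_truncLT t H
  rw [euler, euler, hc _ _ _ hQ hA (heart_truncLT t Y)
    (t.heart.prop_of_iso e.symm (heart_truncLT t Y')), hc.iso e.symm (heart_truncLT t Y'),
    euler_congr hc n ((shiftFunctor C (1 : ℤ)).mapIso (asIso ((t.truncGE 1).map q)))]
  abel

lemma euler_additive (N s : ℕ) : ∀ (x y z : ℕ) (_ : x + y + z = s) (_ : x ≤ N) (_ : y ≤ N)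
    (_ : z ≤ N) {X Y Z : C} {f : X ⟶ Y} {g : Y ⟶ Z} {h : Z ⟶ X⟦(1 : ℤ)⟧}
    (_ : Triangle.mk f g h ∈ distTriang C) [t.IsGE X 0] [t.IsGE Y 0] [t.IsGE Z 0]
    [t.IsLE X (x - 1)] [t.IsLE Y (y - 1)] [t.IsLE Z (z - 1)],
    euler t c N Y = euler t c N X + euler t c N Z := by
  induction s with
  | zero =>
    intro x y z hs _ _ _ X Y Z f g h H _ _ _ hX hY hZ
    obtain ⟨⟨rfl, rfl⟩, rfl⟩ : (x = 0 ∧ y = 0) ∧ z = 0 := by lia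
    have : t.IsLE X (-1) := hX
    have : t.IsLE Y (-1) := hY
    have : t.IsLE Z (-1) := hZ
    rw [euler_isZero hc N (t.isZero X (-1) 0), euler_isZero hc N (t.isZero Y (-1) 0),
      euler_isZero hc N (t.isZero Z (-1) 0), add_zero]
  | succ s ih =>
    intro x y z hs hx hy hz X Y Z f g h H _ _ _ hX hY hZ
    obtain _ | x := x
    · have : t.IsLE X (-1) := hX
      have hX0 := t.isZero X (-1) 0
      have : IsIso g := (Triangle.isZero₁_iff_isIso₂ _ H).1 hX0
      rw [euler_isZero hc N hX0, zero_add, euler_congr hc N (asIso g)]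
    · obtain _ | N := N
      · lia
      have hA : t.heart ((t.truncLT 1).obj X) := heart_truncLT t X
      have := ((t.mem_heart_iff _).1 hA).1
      have := t.isGE_truncGE_obj X 1 1
      have := isGE_shift_truncGE t X
      obtain ⟨i, p, d, hT⟩ := exists_distTriang_truncLT_truncGE t X
      obtain ⟨Y', q, δ, hY'⟩ := distinguished_cocone_triangle (i ≫ f)
      have := isGE_cone t hT H hY'
      obtain ⟨u, v, w, huv⟩ := exists_distTriang_of_trunc t hT H hY'
      have hvw : Triangle.mk v w (-u⟦(1 : ℤ)⟧') ∈ distTriang C := rot_of_distTriang _ huv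
      have : t.IsLE X x := t.isLE_of_le X ((x + 1 : ℕ) - 1 : ℤ) x
      have h₁ : t.IsLE ((t.truncGE 1).obj X) x := isLE_of_distTriang t hT x (by lia)
      have h₂ : t.IsLE (((t.truncGE 1).obj X)⟦(1 : ℤ)⟧) (x - 1) := t.isLE_shift _ x 1 (x - 1)
      have h₃ : t.IsLE Y' (y - 1) := isLE_of_distTriang t hY' (y - 1) (by lia)
      rw [euler_of_heart_distTriang hc N hY' hA, euler_succ hc N hT,
        ih y z x (by lia) hy hz (by lia) hvw,
        euler_eq_of_le hc (n := x) (m := N) (by lia) (((t.truncGE 1).obj X)⟦(1 : ℤ)⟧),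
        euler_eq_of_le hc (n := x) (m := N + 1) (by lia) (((t.truncGE 1).obj X)⟦(1 : ℤ)⟧)]
      abel

lemma euler_shift_neg_one (n : ℕ) (X : C) [t.IsGE X 0] :
    euler t c (n + 1) (X⟦(-1 : ℤ)⟧) = -euler t c n X := by
  have h₁ : t.IsGE (X⟦(-1 : ℤ)⟧) 1 := t.isGE_shift X 0 (-1) 1
  have h₀ : t.IsGE (X⟦(-1 : ℤ)⟧) 0 := t.isGE_of_ge _ 0 1
  have H : Triangle.mk (0 : (0 : C) ⟶ X⟦(-1 : ℤ)⟧) (𝟙 _) 0 ∈ distTriang C :=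
    contractible_distinguished₁ (X⟦(-1 : ℤ)⟧)
  have e : X⟦(-1 : ℤ)⟧⟦(1 : ℤ)⟧ ≅ X := (shiftEquiv C (1 : ℤ)).counitIso.app X
  rw [euler_succ hc n H, hc.isZero (isZero_zero C), zero_sub,
    euler_congr hc n e.symm]

omit hc in
variable (t c) in
/-- The Euler characteristic of an object of amplitude contained in `[-k, k]`. -/
noncomputable def shiftedEuler (k : ℕ) (X : C) : G :=
  (-1 : ℤ) ^ k • euler t c (2 * k + 1) (X⟦(-k : ℤ)⟧)

lemma shiftedEuler_succ (k : ℕ) (X : C) [t.IsGE X (-k)] [t.IsLE X k] :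
    shiftedEuler t c (k + 1) X = shiftedEuler t c k X := by
  have h₁ : t.IsGE (X⟦(-k : ℤ)⟧) 0 := t.isGE_shift X (-k) (-k) 0
  have h₂ : t.IsLE (X⟦(-k : ℤ)⟧) ((2 * k + 1 : ℕ) - 1) := t.isLE_shift X k (-k) _
  have e : X⟦(-k : ℤ)⟧⟦(-1 : ℤ)⟧ ≅ X⟦(-(k + 1 : ℕ) : ℤ)⟧ :=
    ((shiftFunctorAdd' C (-k : ℤ) (-1) _ (by push_cast; ring)).app X).symm
  have h₃ : t.IsGE (X⟦(-k : ℤ)⟧⟦(-1 : ℤ)⟧) 1 := t.isGE_shift _ 0 (-1) 1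
  have h₄ : t.IsGE (X⟦(-k : ℤ)⟧⟦(-1 : ℤ)⟧) 0 := t.isGE_of_ge _ 0 1
  rw [shiftedEuler, shiftedEuler, ← euler_congr hc _ e, euler_shift_neg_one hc,
    show 2 * (k + 1) = 2 * k + 1 + 1 by ring, euler_succ_of_isLE hc, pow_succ]
  simp

lemma shiftedEuler_eq_of_le {k m : ℕ} (hkm : k ≤ m) (X : C) [t.IsGE X (-k)] [t.IsLE X k] :
    shiftedEuler t c m X = shiftedEuler t c k X := by
  induction m, hkm using Nat.le_induction with
  | base => rfl
  | succ m hm ih =>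
    have := t.isGE_of_ge X (-m : ℤ) (-k)
    have := t.isLE_of_le X k m
    rw [shiftedEuler_succ hc, ih]

lemma shiftedEuler_zero {X : C} (hX : t.heart X) : shiftedEuler t c 0 X = c X := by
  obtain ⟨_, _⟩ := (t.mem_heart_iff X).1 hX
  have H : Triangle.mk (𝟙 X) (0 : X ⟶ 0) 0 ∈ distTriang C := contractible_distinguished X
  have e : X⟦(-(0 : ℕ) : ℤ)⟧ ≅ X := (shiftFunctorZero' C _ (by simp)).app X
  have := t.isGE_of_iso e.symm 0
  rw [shiftedEuler, euler_congr hc _ e, mul_zero, euler_succ hc 0 H, euler]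
  simp

lemma shiftedEuler_additive (k : ℕ) {X Y Z : C} {f : X ⟶ Y} {g : Y ⟶ Z} {h : Z ⟶ X⟦(1 : ℤ)⟧}
    (H : Triangle.mk f g h ∈ distTriang C) [t.IsGE X (-k)] [t.IsLE X k] [t.IsGE Y (-k)]
    [t.IsLE Y k] [t.IsGE Z (-k)] [t.IsLE Z k] :
    shiftedEuler t c k Y = shiftedEuler t c k X + shiftedEuler t c k Z := by
  have (W : C) [t.IsGE W (-k)] : t.IsGE (W⟦(-k : ℤ)⟧) 0 := t.isGE_shift W (-k) (-k) 0
  have (W : C) [t.IsLE W k] : t.IsLE (W⟦(-k : ℤ)⟧) ((2 * k + 1 : ℕ) - 1) :=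
    t.isLE_shift W k (-k) _
  obtain ⟨f', g', h', H'⟩ : ∃ (f' : X⟦(-k : ℤ)⟧ ⟶ Y⟦(-k : ℤ)⟧) (g' : Y⟦(-k : ℤ)⟧ ⟶ Z⟦(-k : ℤ)⟧)
      (h' : Z⟦(-k : ℤ)⟧ ⟶ X⟦(-k : ℤ)⟧⟦(1 : ℤ)⟧), Triangle.mk f' g' h' ∈ distTriang C :=
    ⟨_, _, _, Triangle.shift_distinguished _ H (-k)⟩
  rw [shiftedEuler, shiftedEuler, shiftedEuler,
    euler_additive hc (2 * k + 1) _ _ _ _ rfl le_rfl le_rfl le_rfl H', smul_add]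

/-- For a bounded `t`-structure, a function which is additive on the heart extends to a function
which is additive on all distinguished triangles. -/
lemma exists_additive_extension (hb : ∀ X : C, ∃ k : ℕ, t.IsGE X (-k) ∧ t.IsLE X k) :
    ∃ χ : C → G, (∀ X, t.heart X → χ X = c X) ∧
      ∀ T ∈ distTriang C, χ T.obj₂ = χ T.obj₁ + χ T.obj₃ := by
  choose k hk₁ hk₂ using hb
  have key {X : C} {m : ℕ} (hm : k X ≤ m) : shiftedEuler t c (k X) X = shiftedEuler t c m X := by
    have := hk₁ X
    have := hk₂ X
    exact (shiftedEuler_eq_of_le hc hm X).symm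
  refine ⟨fun X ↦ shiftedEuler t c (k X) X, fun X hX ↦ ?_, fun T hT ↦ ?_⟩
  · obtain ⟨h₁, h₂⟩ := (t.mem_heart_iff X).1 hX
    have : t.IsGE X (-(0 : ℕ)) := by simpa
    have : t.IsLE X (0 : ℕ) := by simpa
    rw [← shiftedEuler_zero hc hX]
    exact shiftedEuler_eq_of_le hc (Nat.zero_le _) X
  · obtain ⟨m, hm⟩ : ∃ m, m = k T.obj₁ + k T.obj₂ + k T.obj₃ := ⟨_, rfl⟩
    have hGE (X : C) (hX : k X ≤ m) : t.IsGE X (-m) := by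
      have := hk₁ X
      exact t.isGE_of_ge X (-m) (-k X)
    have hLE (X : C) (hX : k X ≤ m) : t.IsLE X m := by
      have := hk₂ X
      exact t.isLE_of_le X (k X) m
    have := hGE T.obj₁ (by lia)
    have := hGE T.obj₂ (by lia)
    have := hGE T.obj₃ (by lia)
    have := hLE T.obj₁ (by lia)
    have := hLE T.obj₂ (by lia)
    have := hLE T.obj₃ (by lia)
    dsimp only
    rw [key (X := T.obj₁) (m := m) (by lia), key (X := T.obj₂) (m := m) (by lia),
      key (X := T.obj₃) (m := m) (by lia)]
    exact shiftedEuler_additive hc m (f := T.mor₁) (g := T.mor₂) (h := T.mor₃) hT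

end Euler

section Uniqueness

open Triangulated ZeroObject

variable {C} {G : Type*} [AddCommGroup G] {χ : C → G}
  (hχ : ∀ T ∈ distTriang C, χ T.obj₂ = χ T.obj₁ + χ T.obj₃)

include hχ

lemma additive_isZero {X : C} (hX : IsZero X) : χ X = 0 := by
  have H : Triangle.mk (𝟙 X) (0 : X ⟶ X) 0 ∈ distTriang C :=
    (Triangle.distinguished_iff_of_isZero₃ (Triangle.mk (𝟙 X) (0 : X ⟶ X) 0) hX).2
      (inferInstanceAs (IsIso (𝟙 X)))
  simpa using hχ _ H

lemma additive_iso {X Y : C} (e : X ≅ Y) : χ X = χ Y := by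
  have H : Triangle.mk e.hom (0 : Y ⟶ 0) 0 ∈ distTriang C :=
    (Triangle.distinguished_iff_of_isZero₃ (Triangle.mk e.hom (0 : Y ⟶ 0) 0) (isZero_zero C)).2
      (inferInstanceAs (IsIso e.hom))
  have h : χ Y = χ X + χ (0 : C) := hχ _ H
  rw [h, additive_isZero hχ (isZero_zero C), add_zero]

lemma additive_shift (X : C) : χ (X⟦(1 : ℤ)⟧) = -χ X := by
  have : χ (0 : C) = χ X + χ (X⟦(1 : ℤ)⟧) := hχ _ (contractible_distinguished₂ X)
  have h0 : χ (0 : C) = 0 := additive_isZero hχ (isZero_zero C)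
  rw [h0] at this
  exact (neg_eq_of_add_eq_zero_right this.symm).symm

/-- An additive function on a triangulated category with a bounded `t`-structure is determined by
its values on the heart. -/
lemma additive_eq_zero (t : TStructure C) (hb : ∀ X : C, ∃ k : ℕ, t.IsGE X (-k) ∧ t.IsLE X k)
    (h0 : ∀ X, t.heart X → χ X = 0) (X : C) : χ X = 0 := by
  have nonneg (n : ℕ) : ∀ (X : C) [t.IsGE X 0] [t.IsLE X (n - 1)], χ X = 0 := by
    induction n with
    | zero =>
      intro X _ h
      have : t.IsLE X (-1) := h
      exact additive_isZero hχ (t.isZero X (-1) 0)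
    | succ n ih =>
      intro X _ _
      have := isGE_shift_truncGE t X
      have h₁ : t.IsLE ((t.truncLT 1).obj X) 0 := t.isLE_truncLT_obj ..
      have h₂ : t.IsLE X n := t.isLE_of_le _ ((n + 1 : ℕ) - 1 : ℤ) n
      obtain ⟨i, p, d, hT⟩ := exists_distTriang_truncLT_truncGE t X
      have h₃ : t.IsLE ((t.truncGE 1).obj X) n := isLE_of_distTriang t hT n (by lia)
      have h₄ : t.IsLE (((t.truncGE 1).obj X)⟦(1 : ℤ)⟧) (n - 1) := t.isLE_shift _ n 1 (n - 1)
      have h₅ := additive_shift hχ ((t.truncGE 1).obj X)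
      rw [ih] at h₅
      have h₆ : χ X = χ ((t.truncLT 1).obj X) + χ ((t.truncGE 1).obj X) := hχ _ hT
      rw [h₆, h0 _ (heart_truncLT t X), zero_add, ← neg_eq_zero, ← h₅]
  have bounded (k : ℕ) : ∀ (X : C) [t.IsGE X (-k)] (n : ℤ) [t.IsLE X n], χ X = 0 := by
    induction k with
    | zero =>
      intro X hX n _
      have : t.IsGE X 0 := by simpa using hX
      have : t.IsLE X ((n + 1).toNat - 1) := t.isLE_of_le X n _
      exact nonneg (n + 1).toNat X
    | succ k ih =>
      intro X _ n _
      have : t.IsGE (X⟦(-1 : ℤ)⟧) (-k) := t.isGE_shift X (-(k + 1 : ℕ)) (-1) (-k)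
      have : t.IsLE (X⟦(-1 : ℤ)⟧) (n + 1) := t.isLE_shift X n (-1) (n + 1)
      have e : X⟦(-1 : ℤ)⟧⟦(1 : ℤ)⟧ ≅ X := (shiftEquiv C (1 : ℤ)).counitIso.app X
      rw [← additive_iso hχ e, additive_shift hχ, ih _ (n + 1), neg_zero]
  obtain ⟨k, _, _⟩ := hb X
  exact bounded k X k

end Uniqueness
section Aisle

open Triangulated

variable {C} {D : Set C}

omit [HasZeroObject C] [HasShift C ℤ] [∀ n : ℤ, (CategoryTheory.shiftFunctor C n).Additive]
  [Pretriangulated C] in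
lemma perpSet_of_iso {X Y : C} (e : X ≅ Y) (hX : X ∈ perpSet C D) : Y ∈ perpSet C D :=
  fun d hd φ ↦ by rw [← cancel_mono e.inv, hX d hd (φ ≫ e.inv), zero_comp]

variable (hD : IsTStructure C D)

include hD

lemma IsTStructure.shift_perpSet {X : C} (hX : X ∈ perpSet C D) :
    X⟦(-1 : ℤ)⟧ ∈ perpSet C D := fun d hd φ ↦ by
  have e : X⟦(-1 : ℤ)⟧⟦(1 : ℤ)⟧ ≅ X := (shiftEquiv C (1 : ℤ)).counitIso.app X
  apply (CategoryTheory.shiftFunctor C (1 : ℤ)).map_injective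
  rw [Functor.map_zero, ← cancel_mono e.hom, zero_comp]
  exact hX _ (hD.shift_mem d hd) _

omit hD in
/-- The `t`-structure with a given aisle. -/
def IsTStructure.tStructure (hD : IsTStructure C D) : TStructure C where
  le n X := X⟦n⟧ ∈ D
  ge n X := X⟦n - 1⟧ ∈ perpSet C D
  le_isClosedUnderIsomorphisms n :=
    { of_iso e h := hD.isoClosed ((CategoryTheory.shiftFunctor C n).mapIso e) h }
  ge_isClosedUnderIsomorphisms n :=
    { of_iso e h := perpSet_of_iso ((CategoryTheory.shiftFunctor C (n - 1)).mapIso e) h }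
  le_shift n a n' h X hX := hD.isoClosed ((shiftFunctorAdd' C a n' n h).app X) hX
  ge_shift n a n' h X hX :=
    perpSet_of_iso ((shiftFunctorAdd' C a (n' - 1) (n - 1) (by lia)).app X) hX
  zero' X Y f hX hY :=
    perpSet_of_iso ((shiftFunctorZero' C (1 - 1 : ℤ) (by simp)).app Y) hY X
      (hD.isoClosed ((shiftFunctorZero C ℤ).app X) hX) f
  le_zero_le X hX := hD.isoClosed ((shiftFunctorAdd' C (0 : ℤ) 1 1 (by simp)).app X).symm
    (hD.shift_mem _ hX)
  ge_one_le X hX := perpSet_of_iso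
    ((shiftFunctorAdd' C (1 - 1 : ℤ) (-1) (0 - 1) (by simp)).app X).symm (hD.shift_perpSet hX)
  exists_triangle_zero_one X := by
    obtain ⟨d, hd, d', hd', f, g, h, H⟩ := hD.exists_triangle X
    exact ⟨d, d', hD.isoClosed ((shiftFunctorZero C ℤ).app d).symm hd,
      perpSet_of_iso ((shiftFunctorZero' C (1 - 1 : ℤ) (by simp)).app d').symm hd', f, g, h, H⟩

lemma IsTStructure.heart_iff (X : C) : hD.tStructure.heart X ↔ X ∈ heartSet C D := by
  have e := (shiftFunctorZero C ℤ).app X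
  exact and_congr_left fun _ ↦ ⟨hD.isoClosed e, hD.isoClosed e.symm⟩

lemma IsTStructure.exists_isGE_isLE (hDb : IsBounded C D) (X : C) :
    ∃ k : ℕ, hD.tStructure.IsGE X (-k) ∧ hD.tStructure.IsLE X k := by
  obtain ⟨k, hk₁, hk₂⟩ := hDb X
  have : hD.tStructure.IsGE X (-k + 1) :=
    ⟨perpSet_of_iso ((eqToIso (by simp)).app X) hk₂⟩
  exact ⟨k, hD.tStructure.isGE_of_ge X (-k) (-k + 1), ⟨hk₁⟩⟩

end Aisle

section GrothendieckGroup

variable {C}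

/-- The class of an object in the Grothendieck group of the triangulated category. -/
def KTriang.of (X : C) : KTriang C := QuotientAddGroup.mk (FreeAbelianGroup.of X)

lemma KTriang.of_additive (T : Triangle C) (hT : T ∈ distTriang C) :
    of T.obj₂ = of T.obj₁ + of T.obj₃ :=
  QuotientAddGroup.eq_iff_sub_mem.2
    (AddSubgroup.subset_closure ⟨T, hT, sub_add_eq_sub_sub _ _ _⟩)

/-- The homomorphism from `K(C)` induced by a function which is additive on triangles. -/
def KTriang.lift {G : Type*} [AddCommGroup G] (χ : C → G)
    (hχ : ∀ T ∈ distTriang C, χ T.obj₂ = χ T.obj₁ + χ T.obj₃) : KTriang C →+ G :=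
  QuotientAddGroup.lift (triangRel C) (FreeAbelianGroup.lift χ) (by
    rw [triangRel, AddSubgroup.closure_le]
    rintro _ ⟨T, hT, rfl⟩
    simp [hχ T hT])

lemma KTriang.lift_of {G : Type*} [AddCommGroup G] (χ : C → G)
    (hχ : ∀ T ∈ distTriang C, χ T.obj₂ = χ T.obj₁ + χ T.obj₃) (X : C) :
    lift χ hχ (of X) = χ X :=
  FreeAbelianGroup.lift_apply_of χ X

lemma KTriang.hom_ext {G : Type*} [AddCommGroup G] {φ ψ : KTriang C →+ G}
    (h : ∀ X : C, φ (of X) = ψ (of X)) : φ = ψ :=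
  QuotientAddGroup.addMonoidHom_ext _ (FreeAbelianGroup.lift_ext _ _ h)

variable {A : Set C}

/-- The class of an object in the Grothendieck group of the heart. -/
def KHeart.of (X : A) : KHeart C A := QuotientAddGroup.mk (FreeAbelianGroup.of X)

lemma KHeart.of_additive {X Y Z : A} (h : heartTriangle C A X Y Z) : of Y = of X + of Z :=
  QuotientAddGroup.eq_iff_sub_mem.2
    (AddSubgroup.subset_closure ⟨X, Y, Z, h, sub_add_eq_sub_sub _ _ _⟩)

/-- The homomorphism from `K(A)` induced by a function which is additive on short exact
sequences. -/
def KHeart.lift {G : Type*} [AddCommGroup G] (χ : A → G)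
    (hχ : ∀ X Y Z : A, heartTriangle C A X Y Z → χ Y = χ X + χ Z) : KHeart C A →+ G :=
  QuotientAddGroup.lift (heartRel C A) (FreeAbelianGroup.lift χ) (by
    rw [heartRel, AddSubgroup.closure_le]
    rintro _ ⟨X, Y, Z, h, rfl⟩
    simp [hχ X Y Z h])

lemma KHeart.lift_of {G : Type*} [AddCommGroup G] (χ : A → G)
    (hχ : ∀ X Y Z : A, heartTriangle C A X Y Z → χ Y = χ X + χ Z) (X : A) :
    lift χ hχ (of X) = χ X :=
  FreeAbelianGroup.lift_apply_of χ X

lemma KHeart.hom_ext {G : Type*} [AddCommGroup G] {φ ψ : KHeart C A →+ G}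
    (h : ∀ X : A, φ (of X) = ψ (of X)) : φ = ψ :=
  QuotientAddGroup.addMonoidHom_ext _ (FreeAbelianGroup.lift_ext _ _ h)

end GrothendieckGroup

/-- for a bounded t-structure with heart `A`, the inclusion `A ↪ C` induces
an isomorphism `K(A) ≅ K(C)` of Grothendieck groups. -/
theorem K_heart_iso_K_triang (D : Set C) (hD : IsTStructure C D) (hDb : IsBounded C D) :
    ∃ φ : KHeart C (heartSet C D) →+ KTriang C,
      (∀ a : heartSet C D,
        φ (QuotientAddGroup.mk (FreeAbelianGroup.of a)) =
          QuotientAddGroup.mk (FreeAbelianGroup.of (a : C))) ∧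
      Function.Bijective φ := by
  classical
  have hheart := hD.heart_iff
  have hb := hD.exists_isGE_isLE hDb
  set t := hD.tStructure
  let c (X : C) : KHeart C (heartSet C D) :=
    if hX : X ∈ heartSet C D then KHeart.of ⟨X, hX⟩ else 0
  have c_apply (X : C) (hX : X ∈ heartSet C D) : c X = KHeart.of ⟨X, hX⟩ := dif_pos hX
  have hc : AdditiveOnHeart t c := fun X Y Z f g h H hX hY hZ ↦ by
    rw [hheart] at hX hY hZ
    rw [c_apply X hX, c_apply Y hY, c_apply Z hZ]
    exact KHeart.of_additive ⟨hX, hY, hZ, f, g, h, H⟩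
  obtain ⟨χ, hχ, hχ'⟩ := exists_additive_extension hc hb
  let φ : KHeart C (heartSet C D) →+ KTriang C := KHeart.lift (fun X ↦ KTriang.of X.1)
    (fun _ _ _ ⟨_, _, _, _, _, _, H⟩ ↦ KTriang.of_additive _ H)
  have hφ (X : heartSet C D) : φ (KHeart.of X) = KTriang.of X.1 := KHeart.lift_of _ _ X
  let ψ : KTriang C →+ KHeart C (heartSet C D) := KTriang.lift χ hχ'
  have hψ (X : C) : ψ (KTriang.of X) = χ X := KTriang.lift_of _ _ X
  have hψφ : ψ.comp φ = AddMonoidHom.id _ := KHeart.hom_ext fun X ↦ by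
    rw [AddMonoidHom.comp_apply, hφ, hψ, hχ _ ((hheart _).2 X.2), c_apply _ X.2]
    rfl
  have hφψ : φ.comp ψ = AddMonoidHom.id _ := KTriang.hom_ext fun X ↦ by
    rw [AddMonoidHom.comp_apply, hψ, AddMonoidHom.id_apply, ← sub_eq_zero]
    refine additive_eq_zero (χ := fun X ↦ φ (χ X) - KTriang.of X) (fun T hT ↦ ?_) t hb
      (fun X hX ↦ ?_) X
    · simp only [hχ' T hT, KTriang.of_additive T hT, map_add]
      abel
    · have hX' := (hheart X).1 hX
      simp only [hχ X hX, c_apply X hX', hφ, sub_self]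
  exact ⟨φ, hφ, Function.bijective_iff_has_inverse.2
    ⟨ψ, DFunLike.congr_fun hψφ, DFunLike.congr_fun hφψ⟩⟩

end Paper
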